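/- arXiv:1808.00921 — 7 statements merged into one kernel-verified Lean document; each statement's English description precedes it below -/
import Mathlib

section
/- Let γ > 0 with γ ≠ 1, let c > 0, a > 0 and T > 0. Suppose f : [0,T) → ℝ is continuous and satisfies the integral inequality f(t) ≥ a + ∫₀ᵗ c · f(s)^γ ds for every t ∈ [0,T) (in particular f(t) ≥ a > 0 for all such t). Then for every t ∈ [0,T) satisfying (γ−1) · c · a^{γ−1} · t < 1, one has f(t) ≥ a · (1 − (γ−1) · c · a^{γ−1} · t)^{−1/(γ−1)}. -/
theorem pos_of_integral_rpow_le {γ c a T : ℝ} (hc : 0 < c) (ha : 0 < a) {f : ℝ → ℝ}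
    (hf : ContinuousOn f (Set.Ico 0 T))
    (hint : ∀ t ∈ Set.Ico (0 : ℝ) T, a + ∫ s in (0 : ℝ)..t, c * f s ^ γ ≤ f t) :
    ∀ t ∈ Set.Ico (0 : ℝ) T, 0 < f t := by
  intro t ht
  by_contra! hneg
  have hsub : Set.Icc 0 t ⊆ Set.Ico 0 T := fun x hx => ⟨hx.1, hx.2.trans_lt ht.2⟩
  have hK : IsCompact (Set.Icc 0 t ∩ f ⁻¹' Set.Iic 0) :=
    isCompact_Icc.of_isClosed_subset
      ((hf.mono hsub).preimage_isClosed_of_isClosed isClosed_Icc isClosed_Iic)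
      Set.inter_subset_left
  obtain ⟨x, ⟨hx, hfx⟩, hmin⟩ := hK.exists_isLeast ⟨t, ⟨ht.1, le_rfl⟩, hneg⟩
  have hI : 0 ≤ ∫ s in (0 : ℝ)..x, c * f s ^ γ := by
    rw [intervalIntegral.integral_of_le hx.1, MeasureTheory.integral_Ioc_eq_integral_Ioo]
    refine MeasureTheory.setIntegral_nonneg measurableSet_Ioo fun s hs => ?_
    have hfs : 0 ≤ f s := by
      by_contra! h
      exact hs.2.not_ge (hmin ⟨⟨hs.1.le, hs.2.le.trans hx.2⟩, h.le⟩)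
    positivity
  have := hint x (hsub hx)
  have : f x ≤ 0 := hfx
  linarith

/-- The function `F ^ (1 - γ) / (1 - γ)` grows at rate at least `c` when `F' ≥ c * F ^ γ`. -/
theorem rpow_div_add_le_of_deriv_ge {γ c t : ℝ} (hγ1 : γ ≠ 1) (ht : 0 ≤ t) {F F' : ℝ → ℝ}
    (hpos : ∀ s ∈ Set.Icc 0 t, 0 < F s) (hF : ContinuousOn F (Set.Icc 0 t))
    (hF' : ∀ s ∈ Set.Ioo 0 t, HasDerivAt F (F' s) s)
    (hle : ∀ s ∈ Set.Ioo 0 t, c * F s ^ γ ≤ F' s) :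
    F 0 ^ (1 - γ) / (1 - γ) + c * t ≤ F t ^ (1 - γ) / (1 - γ) := by
  have h1 : 1 - γ ≠ 0 := sub_ne_zero.mpr hγ1.symm
  have hmono : MonotoneOn (fun s => F s ^ (1 - γ) / (1 - γ) - c * s) (Set.Icc 0 t) := by
    refine monotoneOn_of_hasDerivWithinAt_nonneg (convex_Icc 0 t)
      (f' := fun s => F' s * (1 - γ) * F s ^ (1 - γ - 1) / (1 - γ) - c * 1) ?_ ?_ ?_
    · exact ((hF.rpow_const fun s hs => Or.inl (hpos s hs).ne').div_const _).sub (by fun_prop)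
    · intro s hs
      rw [interior_Icc] at hs
      exact ((((hF' s hs).rpow_const (Or.inl (hpos s (Set.Ioo_subset_Icc_self hs)).ne')).div_const
        _).sub ((hasDerivAt_id s).const_mul c)).hasDerivWithinAt
    · intro s hs
      rw [interior_Icc] at hs
      have hs0 := hpos s (Set.Ioo_subset_Icc_self hs)
      have hexp : F s ^ (1 - γ - 1) = (F s ^ γ)⁻¹ := by
        rw [← Real.rpow_neg hs0.le]; congr 1; ring
      have : F' s * (1 - γ) * F s ^ (1 - γ - 1) / (1 - γ) = F' s / F s ^ γ := by
        rw [hexp]; field_simp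
      rw [this, mul_one, sub_nonneg, le_div_iff₀ (Real.rpow_pos_of_pos hs0 γ)]
      exact hle s hs
  have := hmono ⟨le_rfl, ht⟩ ⟨ht, le_rfl⟩ ht
  simp only [mul_zero, sub_zero] at this
  linarith

theorem mul_rpow_le_of_rpow_div_add_le {γ c a t y : ℝ} (hγ1 : γ ≠ 1) (ha : 0 < a) (hy : 0 < y)
    (hX : (γ - 1) * c * a ^ (γ - 1) * t < 1)
    (h : a ^ (1 - γ) / (1 - γ) + c * t ≤ y ^ (1 - γ) / (1 - γ)) :
    a * (1 - (γ - 1) * c * a ^ (γ - 1) * t) ^ (-(1 / (γ - 1))) ≤ y := by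
  have h1 : 1 - γ ≠ 0 := sub_ne_zero.mpr hγ1.symm
  have hX0 : 0 < 1 - (γ - 1) * c * a ^ (γ - 1) * t := sub_pos.mpr hX
  have haγ : a ^ (1 - γ) * a ^ (γ - 1) = 1 := by
    rw [← Real.rpow_add ha]; simp
  have hZ : a ^ (1 - γ) * (1 - (γ - 1) * c * a ^ (γ - 1) * t)
      = (1 - γ) * (a ^ (1 - γ) / (1 - γ) + c * t) := by
    field_simp
    linear_combination (1 - γ) * c * t * haγ
  have hZ0 : 0 < a ^ (1 - γ) * (1 - (γ - 1) * c * a ^ (γ - 1) * t) := by positivity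
  have hexp : -(1 / (γ - 1)) = (1 - γ)⁻¹ := by
    rw [one_div, ← inv_neg, neg_sub]
  have hlhs : a * (1 - (γ - 1) * c * a ^ (γ - 1) * t) ^ (-(1 / (γ - 1)))
      = (a ^ (1 - γ) * (1 - (γ - 1) * c * a ^ (γ - 1) * t)) ^ (1 - γ)⁻¹ := by
    rw [Real.mul_rpow (by positivity) hX0.le, Real.rpow_rpow_inv ha.le h1, hexp]
  have hyy : (1 - γ) * (y ^ (1 - γ) / (1 - γ)) = y ^ (1 - γ) := by field_simp
  rw [hlhs]
  conv_rhs => rw [← Real.rpow_rpow_inv hy.le h1]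
  rcases lt_or_gt_of_ne h1 with hneg | hpos
  · refine Real.rpow_le_rpow_of_nonpos (by positivity) ?_ (inv_nonpos.mpr hneg.le)
    rw [hZ, ← hyy]
    exact mul_le_mul_of_nonpos_left h hneg.le
  · refine Real.rpow_le_rpow hZ0.le ?_ (inv_nonneg.mpr hpos.le)
    rw [hZ, ← hyy]
    exact mul_le_mul_of_nonneg_left h hpos.le

/-- Power-law comparison inequality (lower bound version): if a continuous `f` on `[0,T)`
satisfies `f t ≥ a + ∫₀ᵗ c * f s ^ γ ds`, then `f t ≥ a * (1 - (γ-1) c a^(γ-1) t)^(-1/(γ-1))`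
whenever `(γ-1) c a^(γ-1) t < 1`. -/
theorem stmt0 (γ c a T : ℝ) (hγ : 0 < γ) (hγ1 : γ ≠ 1) (hc : 0 < c) (ha : 0 < a)
    (hT : 0 < T) (f : ℝ → ℝ) (hf : ContinuousOn f (Set.Ico 0 T))
    (hint : ∀ t ∈ Set.Ico (0 : ℝ) T, a + ∫ s in (0 : ℝ)..t, c * f s ^ γ ≤ f t) :
    ∀ t ∈ Set.Ico (0 : ℝ) T, (γ - 1) * c * a ^ (γ - 1) * t < 1 →
      a * (1 - (γ - 1) * c * a ^ (γ - 1) * t) ^ (-(1 / (γ - 1))) ≤ f t := by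
  intro t ht hX
  have hfpos := pos_of_integral_rpow_le hc ha hf hint
  have hsub : Set.Icc 0 t ⊆ Set.Ico 0 T := fun x hx => ⟨hx.1, hx.2.trans_lt ht.2⟩
  have hg : ContinuousOn (fun s => c * f s ^ γ) (Set.Icc 0 t) :=
    continuousOn_const.mul ((hf.mono hsub).rpow_const fun _ _ => Or.inr hγ.le)
  set F : ℝ → ℝ := fun x => a + ∫ s in (0 : ℝ)..x, c * f s ^ γ with hFdef
  have hFpos : ∀ s ∈ Set.Icc 0 t, 0 < F s := fun s hs => by
    have : 0 ≤ ∫ u in (0 : ℝ)..s, c * f u ^ γ :=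
      intervalIntegral.integral_nonneg hs.1 fun u hu => by
        have := hfpos u (hsub ⟨hu.1, hu.2.trans hs.2⟩)
        positivity
    exact add_pos_of_pos_of_nonneg ha this
  have hFcont : ContinuousOn F (Set.Icc 0 t) := by
    refine continuousOn_const.add ?_
    have := intervalIntegral.continuousOn_primitive_interval (μ := MeasureTheory.volume)
      (a := 0) (b := t) (f := fun s => c * f s ^ γ)
      (by rw [Set.uIcc_of_le ht.1]; exact hg.integrableOn_Icc)
    rwa [Set.uIcc_of_le ht.1] at this
  have hFderiv : ∀ s ∈ Set.Ioo 0 t, HasDerivAt F (c * f s ^ γ) s := fun s hs => by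
    refine HasDerivAt.const_add a (intervalIntegral.integral_hasDerivAt_right ?_ ?_ ?_)
    · exact (hg.mono (Set.Icc_subset_Icc_right hs.2.le)).intervalIntegrable_of_Icc hs.1.le
    · exact (hg.mono Set.Ioo_subset_Icc_self).stronglyMeasurableAtFilter isOpen_Ioo s hs
    · exact hg.continuousAt (Icc_mem_nhds hs.1 hs.2)
  have hle : ∀ s ∈ Set.Ioo 0 t, c * F s ^ γ ≤ c * f s ^ γ := fun s hs => by
    have hs' := Set.Ioo_subset_Icc_self hs
    have := (hFpos s hs').le
    have := hint s (hsub hs')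
    gcongr
  have hgrow := rpow_div_add_le_of_deriv_ge hγ1 ht.1 hFpos hFcont hFderiv hle
  have hF0 : F 0 = a := by simp [hFdef]
  rw [hF0] at hgrow
  exact (mul_rpow_le_of_rpow_div_add_le hγ1 ha (hFpos t ⟨ht.1, le_rfl⟩) hX hgrow).trans (hint t ht)
end

section
/- Let γ > 0 with γ ≠ 1, let c > 0, a > 0 and T > 0. Suppose f : [0,T) → ℝ is continuous, nonnegative, and satisfies the reverse integral inequality f(t) ≤ a + ∫₀ᵗ c · f(s)^γ ds for every t ∈ [0,T). Then for every t ∈ [0,T) satisfying (γ−1) · c · a^{γ−1} · t < 1, one has f(t) ≤ a · (1 − (γ−1) · c · a^{γ−1} · t)^{−1/(γ−1)}. -/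
open Set in
/-- A function `u ≥ a > 0` with `u' ≤ c u ^ γ` satisfies the integrated separated inequality. -/
theorem rpow_div_le_of_deriv_le_rpow {γ c t : ℝ} (hγ1 : γ ≠ 1) (ht : 0 ≤ t)
    {u u' : ℝ → ℝ} (hu : ∀ x, HasDerivAt u (u' x) x) (hpos : ∀ x ∈ Icc 0 t, 0 < u x)
    (hle : ∀ x ∈ Icc 0 t, u' x ≤ c * u x ^ γ) :
    u t ^ (1 - γ) / (1 - γ) ≤ u 0 ^ (1 - γ) / (1 - γ) + c * t := by
  have hne : 1 - γ ≠ 0 := sub_ne_zero.mpr hγ1.symm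
  have hd : ∀ x ∈ Icc 0 t,
      HasDerivAt (fun x => u x ^ (1 - γ) / (1 - γ)) (u' x * u x ^ (-γ)) x := by
    intro x hx
    have h := ((hu x).rpow_const (p := 1 - γ) (Or.inl (hpos x hx).ne')).div_const (1 - γ)
    refine h.congr_deriv ?_
    rw [show 1 - γ - 1 = -γ by ring]
    field_simp
  refine image_le_of_deriv_right_le_deriv_boundary
    (f := fun x => u x ^ (1 - γ) / (1 - γ)) (f' := fun x => u' x * u x ^ (-γ))
    (B := fun x => u 0 ^ (1 - γ) / (1 - γ) + c * x) (B' := fun _ => c)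
    (a := 0) (b := t) (fun x hx => (hd x hx).continuousAt.continuousWithinAt)
    (fun x hx => (hd x (Ico_subset_Icc_self hx)).hasDerivWithinAt) (by simp) (by fun_prop)
    (fun x _ => ?_) (fun x hx => ?_) (right_mem_Icc.mpr ht)
  · simpa using (((hasDerivAt_id x).const_mul c).const_add
      (u 0 ^ (1 - γ) / (1 - γ))).hasDerivWithinAt
  · have hx' := Ico_subset_Icc_self hx
    calc u' x * u x ^ (-γ) ≤ c * u x ^ γ * u x ^ (-γ) :=
          mul_le_mul_of_nonneg_right (hle x hx') (Real.rpow_nonneg (hpos x hx').le _)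
      _ = c := by
          rw [mul_assoc, ← Real.rpow_add (hpos x hx')]
          simp

/-- Solving the separated inequality for the upper bound. -/
theorem le_mul_rpow_of_rpow_div_le {γ c a t y : ℝ} (hγ1 : γ ≠ 1) (ha : 0 < a) (hy : 0 < y)
    (hD : (γ - 1) * c * a ^ (γ - 1) * t < 1)
    (h : y ^ (1 - γ) / (1 - γ) ≤ a ^ (1 - γ) / (1 - γ) + c * t) :
    y ≤ a * (1 - (γ - 1) * c * a ^ (γ - 1) * t) ^ (-(1 / (γ - 1))) := by
  have hne : 1 - γ ≠ 0 := sub_ne_zero.mpr hγ1.symm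
  have haa : a ^ (1 - γ) * a ^ (γ - 1) = 1 := by
    rw [← Real.rpow_add ha]
    simp
  set D := 1 - (γ - 1) * c * a ^ (γ - 1) * t with hDdef
  have hDpos : 0 < D := by linarith
  have hR : a ^ (1 - γ) / (1 - γ) + c * t = a ^ (1 - γ) * D / (1 - γ) := by
    rw [hDdef]
    field_simp
    linear_combination (γ - 1) * c * t * haa
  have hexp : -(1 / (γ - 1)) = (1 - γ)⁻¹ := by
    rw [← neg_sub γ 1, inv_neg, one_div]
  have hB : (a * D ^ (1 - γ)⁻¹) ^ (1 - γ) = a ^ (1 - γ) * D := by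
    rw [Real.mul_rpow ha.le (Real.rpow_nonneg hDpos.le _), Real.rpow_inv_rpow hDpos.le hne]
  have hBpos : 0 < a * D ^ (1 - γ)⁻¹ := by positivity
  rw [hR, ← hB] at h
  rw [hexp]
  rcases lt_or_gt_of_ne hne with hneg | hpos
  · rw [div_le_div_right_of_neg hneg] at h
    exact (Real.rpow_le_rpow_iff_of_neg hBpos hy hneg).mp h
  · rw [div_le_div_iff_of_pos_right hpos] at h
    exact (Real.rpow_le_rpow_iff hy.le hBpos.le hpos).mp h

/-- Power-law comparison inequality (upper bound version): if a continuous nonnegative `f`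
on `[0,T)` satisfies `f t ≤ a + ∫₀ᵗ c * f s ^ γ ds`, then
`f t ≤ a * (1 - (γ-1) c a^(γ-1) t)^(-1/(γ-1))` whenever `(γ-1) c a^(γ-1) t < 1`. -/
theorem stmt1 (γ c a T : ℝ) (hγ : 0 < γ) (hγ1 : γ ≠ 1) (hc : 0 < c) (ha : 0 < a)
    (hT : 0 < T) (f : ℝ → ℝ) (hf : ContinuousOn f (Set.Ico 0 T))
    (hnn : ∀ t ∈ Set.Ico (0 : ℝ) T, 0 ≤ f t)
    (hint : ∀ t ∈ Set.Ico (0 : ℝ) T, f t ≤ a + ∫ s in (0 : ℝ)..t, c * f s ^ γ) :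
    ∀ t ∈ Set.Ico (0 : ℝ) T, (γ - 1) * c * a ^ (γ - 1) * t < 1 →
      f t ≤ a * (1 - (γ - 1) * c * a ^ (γ - 1) * t) ^ (-(1 / (γ - 1))) := by
  intro t ht hD
  have hsub : ∀ x ∈ Set.Icc 0 t, x ∈ Set.Ico 0 T := fun x hx => ⟨hx.1, hx.2.trans_lt ht.2⟩
  -- a globally continuous extension of the integrand makes the integral differentiable everywhere
  let g : ℝ → ℝ := Set.IccExtend ht.1 ((Set.Icc 0 t).domRestrict fun s => c * f s ^ γ)
  have hg : Continuous g := by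
    refine Continuous.Icc_extend' (continuousOn_iff_continuous_domRestrict.mp ?_)
    exact continuousOn_const.mul ((hf.mono hsub).rpow_const fun _ _ => Or.inr hγ.le)
  have hgf : ∀ x ∈ Set.Icc 0 t, g x = c * f x ^ γ := fun x hx =>
    Set.IccExtend_of_mem ht.1 _ hx
  have hgnn : ∀ x ∈ Set.Icc 0 t, 0 ≤ g x := fun x hx => by
    rw [hgf x hx]
    exact mul_nonneg hc.le (Real.rpow_nonneg (hnn x (hsub x hx)) _)
  let u : ℝ → ℝ := fun x => a + ∫ s in (0 : ℝ)..x, g s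
  have hu : ∀ x, HasDerivAt u (g x) x := fun x =>
    (intervalIntegral.integral_hasDerivAt_right (hg.intervalIntegrable _ _)
      (hg.stronglyMeasurableAtFilter _ _) hg.continuousAt).const_add a
  have hfu : ∀ x ∈ Set.Icc 0 t, f x ≤ u x := by
    intro x hx
    refine (hint x (hsub x hx)).trans_eq ?_
    refine congrArg (a + ·) (intervalIntegral.integral_congr fun s hs => ?_)
    rw [Set.uIcc_of_le hx.1] at hs
    exact (hgf s ⟨hs.1, hs.2.trans hx.2⟩).symm
  have hupos : ∀ x ∈ Set.Icc 0 t, 0 < u x := fun x hx =>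
    add_pos_of_pos_of_nonneg ha <| intervalIntegral.integral_nonneg hx.1 fun s hs =>
      hgnn s ⟨hs.1, hs.2.trans hx.2⟩
  have htt : t ∈ Set.Icc 0 t := Set.right_mem_Icc.mpr ht.1
  have key := rpow_div_le_of_deriv_le_rpow (c := c) hγ1 ht.1 hu hupos fun x hx => by
    rw [hgf x hx]
    exact mul_le_mul_of_nonneg_left
      (Real.rpow_le_rpow (hnn x (hsub x hx)) (hfu x hx) hγ.le) hc.le
  have hu0 : u 0 = a := by simp [u]
  rw [hu0] at key
  exact (hfu t htt).trans (le_mul_rpow_of_rpow_div_le hγ1 ha (hupos t htt) hD key)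
end

section
/- Let γ > 1, c > 0, a > 0 and T > 0. Suppose f : [0,T) → ℝ is continuous and satisfies f(t) ≥ a + ∫₀ᵗ c · f(s)^γ ds for every t ∈ [0,T). Then T ≤ t₊₊, where t₊₊ := ((γ−1) · c · a^{γ−1})^{−1} is the blow-up time; that is, no continuous real-valued function can satisfy this integral inequality on an interval [0,T) with T > t₊₊. -/
/-- A continuous `f` dominating `a + ∫₀ᵗ c * f s ^ γ` with `a > 0` stays positive. -/
theorem pos_of_integral_ineq {γ c a T : ℝ} (hc : 0 ≤ c) (ha : 0 < a) {f : ℝ → ℝ}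
    (hf : ContinuousOn f (Set.Ico 0 T))
    (hint : ∀ t ∈ Set.Ico (0 : ℝ) T, a + ∫ s in (0 : ℝ)..t, c * f s ^ γ ≤ f t) :
    ∀ t ∈ Set.Ico (0 : ℝ) T, 0 < f t := by
  intro t ht
  by_contra! hneg
  have hfc : ContinuousOn f (Set.Icc 0 t) :=
    hf.mono fun x hx => ⟨hx.1, hx.2.trans_lt ht.2⟩
  have hcpt : IsCompact (Set.Icc 0 t ∩ f ⁻¹' Set.Iic 0) :=
    isCompact_Icc.of_isClosed_subset
      (hfc.preimage_isClosed_of_isClosed isClosed_Icc isClosed_Iic) Set.inter_subset_left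
  obtain ⟨u, ⟨hu, hfu⟩, hmin⟩ := hcpt.exists_isLeast ⟨t, ⟨ht.1, le_rfl⟩, hneg⟩
  have hnonneg : 0 ≤ ∫ s in (0 : ℝ)..u, c * f s ^ γ := by
    rw [intervalIntegral.integral_of_le hu.1, MeasureTheory.integral_Ioc_eq_integral_Ioo]
    refine MeasureTheory.setIntegral_nonneg measurableSet_Ioo fun s hs => ?_
    have hfs : 0 < f s := by
      by_contra! h
      exact (hmin ⟨⟨hs.1.le, hs.2.le.trans hu.2⟩, h⟩).not_gt hs.2
    positivity
  have h := hint u ⟨hu.1, hu.2.trans_lt ht.2⟩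
  have hfu' : f u ≤ 0 := hfu
  linarith

/-- Blow-up: if `γ > 1` and a continuous `f` on `[0,T)` satisfies
`f t ≥ a + ∫₀ᵗ c * f s ^ γ ds`, then `T ≤ t₊₊ = ((γ-1) c a^(γ-1))⁻¹`. -/
theorem stmt2 (γ c a T : ℝ) (hγ : 1 < γ) (hc : 0 < c) (ha : 0 < a)
    (hT : 0 < T) (f : ℝ → ℝ) (hf : ContinuousOn f (Set.Ico 0 T))
    (hint : ∀ t ∈ Set.Ico (0 : ℝ) T, a + ∫ s in (0 : ℝ)..t, c * f s ^ γ ≤ f t) :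
    T ≤ ((γ - 1) * c * a ^ (γ - 1))⁻¹ := by
  have hpos := pos_of_integral_ineq hc.le ha hf hint
  refine le_of_forall_lt_imp_le_of_dense fun t htT => ?_
  have hγ' : 0 < γ - 1 := sub_pos.2 hγ
  rcases lt_or_ge t 0 with ht0 | ht0
  · exact ht0.le.trans (by positivity)
  have hg : ContinuousOn (fun s => c * f s ^ γ) (Set.Ico 0 T) :=
    continuousOn_const.mul (hf.rpow_const fun x hx => Or.inl (hpos x hx).ne')
  have hgi : ∀ x ∈ Set.Icc 0 t,
      IntervalIntegrable (fun s => c * f s ^ γ) MeasureTheory.volume 0 x := fun x hx =>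
    ContinuousOn.intervalIntegrable_of_Icc hx.1
      (hg.mono fun y hy => ⟨hy.1, (hy.2.trans hx.2).trans_lt htT⟩)
  set F : ℝ → ℝ := fun x => a + ∫ s in (0 : ℝ)..x, c * f s ^ γ with hF
  have hFpos : ∀ x ∈ Set.Icc 0 t, 0 < F x := fun x hx => by
    have : 0 ≤ ∫ s in (0 : ℝ)..x, c * f s ^ γ :=
      intervalIntegral.integral_nonneg hx.1 fun s hs =>
        mul_nonneg hc.le (Real.rpow_nonneg
          (hpos s ⟨hs.1, (hs.2.trans hx.2).trans_lt htT⟩).le _)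
    simp only [hF]
    linarith
  have hFcont : ContinuousOn F (Set.Icc 0 t) := by
    have h := intervalIntegral.continuousOn_primitive_interval'
      (hgi t ⟨ht0, le_rfl⟩) Set.left_mem_uIcc
    rw [Set.uIcc_of_le ht0] at h
    exact continuousOn_const.add h
  have hFderiv : ∀ x ∈ Set.Ioo 0 t, HasDerivAt F (c * f x ^ γ) x := fun x hx => by
    have hgo := hg.mono Set.Ioo_subset_Ico_self
    have hxT : x ∈ Set.Ioo 0 T := ⟨hx.1, hx.2.trans htT⟩
    exact (intervalIntegral.integral_hasDerivAt_right (hgi x ⟨hx.1.le, hx.2.le⟩)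
      (hgo.stronglyMeasurableAtFilter isOpen_Ioo x hxT)
      (hgo.continuousAt (isOpen_Ioo.mem_nhds hxT))).const_add a
  have hanti : AntitoneOn (fun x => F x ^ (1 - γ) + (γ - 1) * c * x) (Set.Icc 0 t) := by
    refine antitoneOn_of_hasDerivWithinAt_nonpos (convex_Icc 0 t)
      (f' := fun x => c * f x ^ γ * (1 - γ) * F x ^ (1 - γ - 1) + (γ - 1) * c * 1)
      ((hFcont.rpow_const fun x hx => Or.inl (hFpos x hx).ne').add (by fun_prop)) ?_ ?_
    · rw [interior_Icc]
      intro x hx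
      exact (((hFderiv x hx).rpow_const
        (Or.inl (hFpos x (Set.Ioo_subset_Icc_self hx)).ne')).add
          ((hasDerivAt_id x).const_mul _)).hasDerivWithinAt
    · rw [interior_Icc]
      intro x hx
      have hFx := hFpos x (Set.Ioo_subset_Icc_self hx)
      have hle : F x ^ γ ≤ f x ^ γ :=
        Real.rpow_le_rpow hFx.le (hint x ⟨hx.1.le, hx.2.trans htT⟩) (by linarith)
      have hone : 1 ≤ f x ^ γ * F x ^ (1 - γ - 1) := by
        calc (1 : ℝ) = F x ^ γ * F x ^ (1 - γ - 1) := by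
              rw [← Real.rpow_add hFx]; simp
          _ ≤ _ := by gcongr
      have := mul_le_mul_of_nonneg_left hone (mul_pos hγ' hc).le
      linarith
  have h := hanti ⟨le_rfl, ht0⟩ ⟨ht0, le_rfl⟩ ht0
  have hFt : 0 < F t ^ (1 - γ) := Real.rpow_pos_of_pos (hFpos t ⟨ht0, le_rfl⟩) _
  have hF0 : F 0 = a := by simp [hF]
  simp only [hF0, mul_zero, add_zero] at h
  rw [mul_inv, ← Real.rpow_neg ha.le, neg_sub, inv_mul_eq_div, le_div_iff₀ (mul_pos hγ' hc)]
  linarith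
end

section
/- Let θ ∈ (0,1), let c₁ ≥ c₂ > 0, λ > 0, a > 0 and T > 0. Suppose m : [0,T] → ℝ is continuous, nonnegative, and satisfies the two-sided integral inequality (1/2)·a + ∫₀ᵗ λ·c₂·m(s)^{1−θ} ds ≤ m(t) ≤ (3/2)·a + ∫₀ᵗ λ·c₁·m(s)^{1−θ} ds for every t ∈ [0,T]. Then for every t ∈ [0,T]: ((a/2)^θ + θ·λ·c₂·t)^{1/θ} ≤ m(t) ≤ ((3a/2)^θ + θ·λ·c₁·t)^{1/θ}. -/
section PowerLawComparison

variable {θ K b T : ℝ} {m : ℝ → ℝ}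

theorem continuousOn_const_mul_rpow (hθ : θ < 1) (hm : ContinuousOn m (Set.Icc 0 T)) :
    ContinuousOn (fun s => K * m s ^ (1 - θ)) (Set.Icc 0 T) :=
  continuousOn_const.mul (hm.rpow_const fun _ _ => Or.inr (by linarith))

theorem le_add_integral_const_mul_rpow (hK : 0 ≤ K) (hnn : ∀ t ∈ Set.Icc (0 : ℝ) T, 0 ≤ m t)
    {t : ℝ} (ht : t ∈ Set.Icc (0 : ℝ) T) :
    b ≤ b + ∫ s in (0 : ℝ)..t, K * m s ^ (1 - θ) := by
  have h : 0 ≤ ∫ s in (0 : ℝ)..t, K * m s ^ (1 - θ) :=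
    intervalIntegral.integral_nonneg ht.1 fun s hs =>
      mul_nonneg hK (Real.rpow_nonneg (hnn s ⟨hs.1, hs.2.trans ht.2⟩) _)
  linarith

theorem continuousOn_add_integral_rpow (hθ : θ < 1) (hb : 0 < b) (hK : 0 ≤ K) (hT : 0 ≤ T)
    (hm : ContinuousOn m (Set.Icc 0 T)) (hnn : ∀ t ∈ Set.Icc (0 : ℝ) T, 0 ≤ m t) :
    ContinuousOn (fun t => (b + ∫ s in (0 : ℝ)..t, K * m s ^ (1 - θ)) ^ θ) (Set.Icc 0 T) := by
  have hint : MeasureTheory.IntegrableOn (fun s => K * m s ^ (1 - θ)) (Set.uIcc 0 T) := by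
    rw [Set.uIcc_of_le hT]
    exact (continuousOn_const_mul_rpow hθ hm).integrableOn_Icc
  have h := intervalIntegral.continuousOn_primitive_interval hint
  rw [Set.uIcc_of_le hT] at h
  exact (continuousOn_const.add h).rpow_const fun t ht =>
    Or.inl (hb.trans_le (le_add_integral_const_mul_rpow hK hnn ht)).ne'

theorem hasDerivAt_add_integral_rpow (hθ : θ < 1) (hb : 0 < b) (hK : 0 ≤ K)
    (hm : ContinuousOn m (Set.Icc 0 T)) (hnn : ∀ t ∈ Set.Icc (0 : ℝ) T, 0 ≤ m t)
    {t : ℝ} (ht : t ∈ Set.Ioo (0 : ℝ) T) :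
    HasDerivAt (fun t => (b + ∫ s in (0 : ℝ)..t, K * m s ^ (1 - θ)) ^ θ)
      (K * m t ^ (1 - θ) * θ * (b + ∫ s in (0 : ℝ)..t, K * m s ^ (1 - θ)) ^ (θ - 1)) t := by
  have hc := continuousOn_const_mul_rpow (K := K) hθ hm
  have hint : IntervalIntegrable (fun s => K * m s ^ (1 - θ)) MeasureTheory.volume 0 t := by
    apply ContinuousOn.intervalIntegrable
    rw [Set.uIcc_of_le ht.1.le]
    exact hc.mono (Set.Icc_subset_Icc_right ht.2.le)
  have h := intervalIntegral.integral_hasDerivAt_right hint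
    ((hc.mono Set.Ioo_subset_Icc_self).stronglyMeasurableAtFilter isOpen_Ioo t ht)
    (hc.continuousAt (Icc_mem_nhds ht.1 ht.2))
  exact (h.const_add b).rpow_const
    (Or.inl (hb.trans_le (le_add_integral_const_mul_rpow hK hnn ⟨ht.1.le, ht.2.le⟩)).ne')

theorem rpow_add_mul_le_of_add_integral_le (hθ : θ ∈ Set.Ioo (0 : ℝ) 1) (hb : 0 < b)
    (hK : 0 ≤ K) (hm : ContinuousOn m (Set.Icc 0 T))
    (hnn : ∀ t ∈ Set.Icc (0 : ℝ) T, 0 ≤ m t)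
    (h : ∀ t ∈ Set.Icc (0 : ℝ) T, b + ∫ s in (0 : ℝ)..t, K * m s ^ (1 - θ) ≤ m t)
    {t : ℝ} (ht : t ∈ Set.Icc (0 : ℝ) T) : (b ^ θ + θ * K * t) ^ (1 / θ) ≤ m t := by
  have hT : 0 ≤ T := ht.1.trans ht.2
  have key := (convex_Icc 0 T).mul_sub_le_image_sub_of_le_deriv (C := θ * K)
    (continuousOn_add_integral_rpow hθ.2 hb hK hT hm hnn)
    (fun s hs => (hasDerivAt_add_integral_rpow hθ.2 hb hK hm hnn
      (by rwa [interior_Icc] at hs)).differentiableAt.differentiableWithinAt)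
    (fun s hs => by
      rw [interior_Icc] at hs
      have hs' := Set.Ioo_subset_Icc_self hs
      rw [(hasDerivAt_add_integral_rpow hθ.2 hb hK hm hnn hs).deriv]
      have hF := hb.trans_le (le_add_integral_const_mul_rpow (b := b) (θ := θ) hK hnn hs')
      have h1 := Real.rpow_le_rpow hF.le (h s hs') (sub_nonneg.2 hθ.2.le)
      generalize b + ∫ s in (0 : ℝ)..s, K * m s ^ (1 - θ) = F at *
      calc θ * K = K * F ^ (1 - θ) * θ * F ^ (θ - 1) := by
            have : F ^ (1 - θ) * F ^ (θ - 1) = 1 := by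
              rw [← Real.rpow_add hF]; simp
            linear_combination -(θ * K) * this
        _ ≤ _ := by
            have := hθ.1.le
            gcongr)
    0 ⟨le_rfl, hT⟩ t ht ht.1
  have hF := hb.trans_le (le_add_integral_const_mul_rpow (b := b) (θ := θ) hK hnn ht)
  simp only [intervalIntegral.integral_same, add_zero, sub_zero] at key
  rw [one_div]
  refine le_trans ?_ (h t ht)
  have h0 : 0 ≤ θ * K * t := mul_nonneg (mul_nonneg hθ.1.le hK) ht.1
  rw [Real.rpow_inv_le_iff_of_pos (by positivity) hF.le hθ.1]
  linarith

theorem le_rpow_add_mul_of_le_add_integral (hθ : θ ∈ Set.Ioo (0 : ℝ) 1) (hb : 0 < b)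
    (hK : 0 ≤ K) (hm : ContinuousOn m (Set.Icc 0 T))
    (hnn : ∀ t ∈ Set.Icc (0 : ℝ) T, 0 ≤ m t)
    (h : ∀ t ∈ Set.Icc (0 : ℝ) T, m t ≤ b + ∫ s in (0 : ℝ)..t, K * m s ^ (1 - θ))
    {t : ℝ} (ht : t ∈ Set.Icc (0 : ℝ) T) : m t ≤ (b ^ θ + θ * K * t) ^ (1 / θ) := by
  have hT : 0 ≤ T := ht.1.trans ht.2
  have key := (convex_Icc 0 T).image_sub_le_mul_sub_of_deriv_le (C := θ * K)
    (continuousOn_add_integral_rpow hθ.2 hb hK hT hm hnn)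
    (fun s hs => (hasDerivAt_add_integral_rpow hθ.2 hb hK hm hnn
      (by rwa [interior_Icc] at hs)).differentiableAt.differentiableWithinAt)
    (fun s hs => by
      rw [interior_Icc] at hs
      have hs' := Set.Ioo_subset_Icc_self hs
      rw [(hasDerivAt_add_integral_rpow hθ.2 hb hK hm hnn hs).deriv]
      have hF := hb.trans_le (le_add_integral_const_mul_rpow (b := b) (θ := θ) hK hnn hs')
      have h1 := Real.rpow_le_rpow (hnn s hs') (h s hs') (sub_nonneg.2 hθ.2.le)
      generalize b + ∫ s in (0 : ℝ)..s, K * m s ^ (1 - θ) = F at *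
      calc _ ≤ K * F ^ (1 - θ) * θ * F ^ (θ - 1) := by
            have := hθ.1.le
            gcongr
        _ = θ * K := by
            have : F ^ (1 - θ) * F ^ (θ - 1) = 1 := by
              rw [← Real.rpow_add hF]; simp
            linear_combination (θ * K) * this)
    0 ⟨le_rfl, hT⟩ t ht ht.1
  have hF := hb.trans_le (le_add_integral_const_mul_rpow (b := b) (θ := θ) hK hnn ht)
  simp only [intervalIntegral.integral_same, add_zero, sub_zero] at key
  rw [one_div]
  refine (h t ht).trans ?_
  have h0 : 0 ≤ θ * K * t := mul_nonneg (mul_nonneg hθ.1.le hK) ht.1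
  rw [Real.le_rpow_inv_iff_of_pos hF.le (by positivity) hθ.1]
  linarith

end PowerLawComparison


/-- Two-sided sublinear power-law comparison (subcritical regime, exponent `1-θ < 1`):
if a continuous nonnegative `m` on `[0,T]` satisfies
`a/2 + ∫₀ᵗ λ c₂ m(s)^(1-θ) ds ≤ m t ≤ 3a/2 + ∫₀ᵗ λ c₁ m(s)^(1-θ) ds`,
then `((a/2)^θ + θ λ c₂ t)^(1/θ) ≤ m t ≤ ((3a/2)^θ + θ λ c₁ t)^(1/θ)`. -/
theorem stmt4 (θ c₁ c₂ lam a T : ℝ) (hθ : θ ∈ Set.Ioo (0 : ℝ) 1)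
    (hc : c₂ ≤ c₁) (hc2 : 0 < c₂) (hlam : 0 < lam) (ha : 0 < a) (hT : 0 < T)
    (m : ℝ → ℝ) (hm : ContinuousOn m (Set.Icc 0 T))
    (hnn : ∀ t ∈ Set.Icc (0 : ℝ) T, 0 ≤ m t)
    (hlow : ∀ t ∈ Set.Icc (0 : ℝ) T,
      a / 2 + ∫ s in (0 : ℝ)..t, lam * c₂ * m s ^ (1 - θ) ≤ m t)
    (hup : ∀ t ∈ Set.Icc (0 : ℝ) T,
      m t ≤ 3 * a / 2 + ∫ s in (0 : ℝ)..t, lam * c₁ * m s ^ (1 - θ)) :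
    ∀ t ∈ Set.Icc (0 : ℝ) T,
      ((a / 2) ^ θ + θ * lam * c₂ * t) ^ (1 / θ) ≤ m t ∧
        m t ≤ ((3 * a / 2) ^ θ + θ * lam * c₁ * t) ^ (1 / θ) := by
  intro t ht
  constructor
  · rw [mul_assoc θ]
    exact rpow_add_mul_le_of_add_integral_le hθ (by positivity) (by positivity) hm hnn hlow ht
  · rw [mul_assoc θ]
    exact le_rpow_add_mul_of_le_add_integral hθ (by positivity)
      (mul_nonneg hlam.le (hc2.le.trans hc)) hm hnn hup ht
end

section
/- Let k > 2, let c₁ ≥ c₂ > 0, λ > 0, a₁ ≥ a₂ > 0 and T > 0. For i = 1,2 set t₊₊ⁱ := ((k−2)·λ·cᵢ·aᵢ^{k−2})^{−1} (so t₊₊¹ ≤ t₊₊²) and gᵢ(t) := aᵢ·(1 − t/t₊₊ⁱ)^{−1/(k−2)}. Suppose m : [0,T] → ℝ is continuous, nonnegative, and satisfies a₂ + ∫₀ᵗ λ·c₂·m(s)^{k−1} ds ≤ m(t) ≤ a₁ + ∫₀ᵗ λ·c₁·m(s)^{k−1} ds for every t ∈ [0,T]. Then g₂(t) ≤ m(t)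 for every t ∈ [0,T] with t < t₊₊², and m(t) ≤ g₁(t) for every t ∈ [0,T] with t < t₊₊¹; moreover T ≤ t₊₊². -/
section PowerLawComparison

variable {a C p T : ℝ} {m : ℝ → ℝ}

private noncomputable def powerPrimitive (a C p : ℝ) (m : ℝ → ℝ) (t : ℝ) : ℝ :=
  a + ∫ s in (0 : ℝ)..t, C * m s ^ (p + 1)

private lemma powerPrimitive_pos (ha : 0 < a) (hC : 0 < C)
    (hnn : ∀ t ∈ Set.Icc (0 : ℝ) T, 0 ≤ m t) {t : ℝ} (ht : t ∈ Set.Icc (0 : ℝ) T) :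
    0 < powerPrimitive a C p m t := by
  have : 0 ≤ ∫ s in (0 : ℝ)..t, C * m s ^ (p + 1) :=
    intervalIntegral.integral_nonneg ht.1 fun s hs =>
      mul_nonneg hC.le (Real.rpow_nonneg (hnn s ⟨hs.1, hs.2.trans ht.2⟩) _)
  unfold powerPrimitive
  linarith

private lemma continuousOn_integrand (hp : 0 < p) (hm : ContinuousOn m (Set.Icc 0 T)) :
    ContinuousOn (fun s => C * m s ^ (p + 1)) (Set.Icc 0 T) :=
  continuousOn_const.mul (hm.rpow_const fun _ _ => Or.inr (by linarith))

private lemma continuousOn_powerPrimitive (hp : 0 < p) (hT : 0 < T)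
    (hm : ContinuousOn m (Set.Icc 0 T)) :
    ContinuousOn (powerPrimitive a C p m) (Set.Icc 0 T) := by
  have hint := (continuousOn_integrand (C := C) hp hm).integrableOn_Icc (μ := MeasureTheory.volume)
  rw [← Set.uIcc_of_le hT.le] at hint ⊢
  exact continuousOn_const.add (intervalIntegral.continuousOn_primitive_interval hint)

private lemma hasDerivAt_powerPrimitive (hp : 0 < p) (hm : ContinuousOn m (Set.Icc 0 T))
    {t : ℝ} (ht : t ∈ Set.Ioo (0 : ℝ) T) :
    HasDerivAt (powerPrimitive a C p m) (C * m t ^ (p + 1)) t := by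
  have hcont := continuousOn_integrand (C := C) hp hm
  refine (intervalIntegral.integral_hasDerivAt_right ?_ ?_ ?_).const_add a
  · refine (hcont.mono ?_).intervalIntegrable
    rw [Set.uIcc_of_le ht.1.le]
    exact Set.Icc_subset_Icc_right ht.2.le
  · exact (hcont.mono Set.Ioo_subset_Icc_self).stronglyMeasurableAtFilter isOpen_Ioo t ht
  · exact hcont.continuousAt (Icc_mem_nhds ht.1 ht.2)

private noncomputable def powerPotential (a C p : ℝ) (m : ℝ → ℝ) (t : ℝ) : ℝ :=
  powerPrimitive a C p m t ^ (-p) + p * C * t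

private lemma continuousOn_powerPotential (ha : 0 < a) (hC : 0 < C) (hp : 0 < p) (hT : 0 < T)
    (hm : ContinuousOn m (Set.Icc 0 T)) (hnn : ∀ t ∈ Set.Icc (0 : ℝ) T, 0 ≤ m t) :
    ContinuousOn (powerPotential a C p m) (Set.Icc 0 T) :=
  ((continuousOn_powerPrimitive hp hT hm).rpow_const
    fun _ ht => Or.inl (powerPrimitive_pos ha hC hnn ht).ne').add (by fun_prop)

private lemma hasDerivAt_powerPotential (ha : 0 < a) (hC : 0 < C) (hp : 0 < p)
    (hm : ContinuousOn m (Set.Icc 0 T)) (hnn : ∀ t ∈ Set.Icc (0 : ℝ) T, 0 ≤ m t)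
    {t : ℝ} (ht : t ∈ Set.Ioo (0 : ℝ) T) :
    HasDerivAt (powerPotential a C p m)
      (p * C * (1 - m t ^ (p + 1) / powerPrimitive a C p m t ^ (p + 1))) t := by
  have hpos := powerPrimitive_pos (p := p) ha hC hnn (Set.Ioo_subset_Icc_self ht)
  refine (((hasDerivAt_powerPrimitive hp hm ht).rpow_const (p := -p) (Or.inl hpos.ne')).add
    ((hasDerivAt_id t).const_mul (p * C))).congr_deriv ?_
  rw [show -p - 1 = -(p + 1) by ring, Real.rpow_neg hpos.le]
  ring

private lemma powerPotential_zero : powerPotential a C p m 0 = a ^ (-p) := by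
  simp [powerPotential, powerPrimitive]

private lemma rpow_neg_le_of_integral_le (ha : 0 < a) (hC : 0 < C) (hp : 0 < p) (hT : 0 < T)
    (hm : ContinuousOn m (Set.Icc 0 T)) (hnn : ∀ t ∈ Set.Icc (0 : ℝ) T, 0 ≤ m t)
    (h : ∀ t ∈ Set.Icc (0 : ℝ) T, powerPrimitive a C p m t ≤ m t)
    {t : ℝ} (ht : t ∈ Set.Icc (0 : ℝ) T) :
    powerPrimitive a C p m t ^ (-p) ≤ a ^ (-p) * (1 - t * (p * C * a ^ p)) := by
  have hanti : AntitoneOn (powerPotential a C p m) (Set.Icc 0 T) := by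
    refine antitoneOn_of_hasDerivWithinAt_nonpos (convex_Icc 0 T)
      (continuousOn_powerPotential ha hC hp hT hm hnn) (fun s hs => by
        rw [interior_Icc] at hs
        exact (hasDerivAt_powerPotential ha hC hp hm hnn hs).hasDerivWithinAt) fun s hs => ?_
    have hs' := interior_subset hs
    have hpos := powerPrimitive_pos (p := p) ha hC hnn hs'
    refine mul_nonpos_of_nonneg_of_nonpos (by positivity) (sub_nonpos.2 ?_)
    rw [one_le_div (by positivity)]
    exact Real.rpow_le_rpow hpos.le (h s hs') (by linarith)
  have h0 := hanti (Set.left_mem_Icc.2 hT.le) ht ht.1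
  rw [powerPotential_zero] at h0
  have hone : a ^ (-p) * a ^ p = 1 := by rw [← Real.rpow_add ha]; simp
  unfold powerPotential at h0
  linear_combination h0 + t * p * C * hone

private lemma le_rpow_neg_of_le_integral (ha : 0 < a) (hC : 0 < C) (hp : 0 < p) (hT : 0 < T)
    (hm : ContinuousOn m (Set.Icc 0 T)) (hnn : ∀ t ∈ Set.Icc (0 : ℝ) T, 0 ≤ m t)
    (h : ∀ t ∈ Set.Icc (0 : ℝ) T, m t ≤ powerPrimitive a C p m t)
    {t : ℝ} (ht : t ∈ Set.Icc (0 : ℝ) T) :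
    a ^ (-p) * (1 - t * (p * C * a ^ p)) ≤ powerPrimitive a C p m t ^ (-p) := by
  have hmono : MonotoneOn (powerPotential a C p m) (Set.Icc 0 T) := by
    refine monotoneOn_of_hasDerivWithinAt_nonneg (convex_Icc 0 T)
      (continuousOn_powerPotential ha hC hp hT hm hnn) (fun s hs => by
        rw [interior_Icc] at hs
        exact (hasDerivAt_powerPotential ha hC hp hm hnn hs).hasDerivWithinAt) fun s hs => ?_
    have hs' := interior_subset hs
    have hpos := powerPrimitive_pos (p := p) ha hC hnn hs'
    refine mul_nonneg (by positivity) (sub_nonneg.2 ?_)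
    rw [div_le_one (by positivity)]
    exact Real.rpow_le_rpow (hnn s hs') (h s hs') (by linarith)
  have h0 := hmono (Set.left_mem_Icc.2 hT.le) ht ht.1
  rw [powerPotential_zero] at h0
  have hone : a ^ (-p) * a ^ p = 1 := by rw [← Real.rpow_add ha]; simp
  unfold powerPotential at h0
  linear_combination h0 - t * p * C * hone

private lemma rpow_neg_rpow_neg_one_div {M : ℝ} (hM : 0 < M) (hp : 0 < p) :
    (M ^ (-p)) ^ (-(1 / p)) = M := by
  rw [← Real.rpow_mul hM.le, show -p * -(1 / p) = 1 by field_simp, Real.rpow_one]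

private lemma mul_rpow_le_of_rpow_neg_le {M x : ℝ} (ha : 0 < a) (hM : 0 < M) (hx : 0 < x)
    (hp : 0 < p) (h : M ^ (-p) ≤ a ^ (-p) * x) : a * x ^ (-(1 / p)) ≤ M := by
  have hle := Real.rpow_le_rpow_of_nonpos (Real.rpow_pos_of_pos hM _) h
    (neg_nonpos.2 (one_div_pos.2 hp).le)
  rwa [Real.mul_rpow (Real.rpow_nonneg ha.le _) hx.le, rpow_neg_rpow_neg_one_div ha hp,
    rpow_neg_rpow_neg_one_div hM hp] at hle

private lemma le_mul_rpow_of_le_rpow_neg {M x : ℝ} (ha : 0 < a) (hM : 0 < M) (hx : 0 < x)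
    (hp : 0 < p) (h : a ^ (-p) * x ≤ M ^ (-p)) : M ≤ a * x ^ (-(1 / p)) := by
  have hle := Real.rpow_le_rpow_of_nonpos (mul_pos (Real.rpow_pos_of_pos ha _) hx) h
    (neg_nonpos.2 (one_div_pos.2 hp).le)
  rwa [Real.mul_rpow (Real.rpow_nonneg ha.le _) hx.le, rpow_neg_rpow_neg_one_div ha hp,
    rpow_neg_rpow_neg_one_div hM hp] at hle

end PowerLawComparison


/-- Two-sided superlinear power-law comparison with blow-up (supercritical regime, `k > 2`):
if a continuous nonnegative `m` on `[0,T]` satisfies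
`a₂ + ∫₀ᵗ λ c₂ m(s)^(k-1) ds ≤ m t ≤ a₁ + ∫₀ᵗ λ c₁ m(s)^(k-1) ds`,
then `g₂ ≤ m` before `t₊₊²`, `m ≤ g₁` before `t₊₊¹`, and `T ≤ t₊₊²`,
where `t₊₊ⁱ = ((k-2) λ cᵢ aᵢ^(k-2))⁻¹` and `gᵢ t = aᵢ (1 - t/t₊₊ⁱ)^(-1/(k-2))`. -/
theorem stmt5 (k c₁ c₂ lam a₁ a₂ T : ℝ) (hk : 2 < k)
    (hc : c₂ ≤ c₁) (hc2 : 0 < c₂) (hlam : 0 < lam)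
    (ha : a₂ ≤ a₁) (ha2 : 0 < a₂) (hT : 0 < T)
    (t₁ t₂ : ℝ)
    (ht1 : t₁ = ((k - 2) * lam * c₁ * a₁ ^ (k - 2))⁻¹)
    (ht2 : t₂ = ((k - 2) * lam * c₂ * a₂ ^ (k - 2))⁻¹)
    (g₁ g₂ : ℝ → ℝ)
    (hg1 : g₁ = fun t => a₁ * (1 - t / t₁) ^ (-(1 / (k - 2))))
    (hg2 : g₂ = fun t => a₂ * (1 - t / t₂) ^ (-(1 / (k - 2))))
    (m : ℝ → ℝ) (hm : ContinuousOn m (Set.Icc 0 T))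
    (hnn : ∀ t ∈ Set.Icc (0 : ℝ) T, 0 ≤ m t)
    (hlow : ∀ t ∈ Set.Icc (0 : ℝ) T,
      a₂ + ∫ s in (0 : ℝ)..t, lam * c₂ * m s ^ (k - 1) ≤ m t)
    (hup : ∀ t ∈ Set.Icc (0 : ℝ) T,
      m t ≤ a₁ + ∫ s in (0 : ℝ)..t, lam * c₁ * m s ^ (k - 1)) :
    (∀ t ∈ Set.Icc (0 : ℝ) T, t < t₂ → g₂ t ≤ m t) ∧
      (∀ t ∈ Set.Icc (0 : ℝ) T, t < t₁ → m t ≤ g₁ t) ∧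
      T ≤ t₂ := by
  have hp : 0 < k - 2 := by linarith
  have ha1 : 0 < a₁ := ha2.trans_le ha
  have hc1 : 0 < c₁ := hc2.trans_le hc
  have hC1 : 0 < lam * c₁ := mul_pos hlam hc1
  have hC2 : 0 < lam * c₂ := mul_pos hlam hc2
  have hk1 : k - 1 = k - 2 + 1 := by ring
  rw [hk1] at hlow hup
  have hpos1 : 0 < t₁ := by rw [ht1]; positivity
  have hpos2 : 0 < t₂ := by rw [ht2]; positivity
  have hdiv1 (t : ℝ) : t * ((k - 2) * (lam * c₁) * a₁ ^ (k - 2)) = t / t₁ := by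
    rw [ht1, div_inv_eq_mul]; ring
  have hdiv2 (t : ℝ) : t * ((k - 2) * (lam * c₂) * a₂ ^ (k - 2)) = t / t₂ := by
    rw [ht2, div_inv_eq_mul]; ring
  subst hg1 hg2
  refine ⟨fun t ht htt => ?_, fun t ht htt => ?_, ?_⟩
  · have h := rpow_neg_le_of_integral_le ha2 hC2 hp hT hm hnn hlow ht
    rw [hdiv2] at h
    exact (mul_rpow_le_of_rpow_neg_le ha2 (powerPrimitive_pos ha2 hC2 hnn ht)
      (sub_pos.2 ((div_lt_one hpos2).2 htt)) hp h).trans (hlow t ht)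
  · have h := le_rpow_neg_of_le_integral ha1 hC1 hp hT hm hnn hup ht
    rw [hdiv1] at h
    exact (hup t ht).trans (le_mul_rpow_of_le_rpow_neg ha1 (powerPrimitive_pos ha1 hC1 hnn ht)
      (sub_pos.2 ((div_lt_one hpos1).2 htt)) hp h)
  · have hTmem : T ∈ Set.Icc (0 : ℝ) T := Set.right_mem_Icc.2 hT.le
    have h := rpow_neg_le_of_integral_le ha2 hC2 hp hT hm hnn hlow hTmem
    rw [hdiv2] at h
    have hlt := (Real.rpow_pos_of_pos (powerPrimitive_pos ha2 hC2 hnn hTmem) _).trans_le h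
    exact (div_le_one hpos2).1
      (sub_pos.1 (pos_of_mul_pos_right hlt (Real.rpow_pos_of_pos ha2 _).le)).le
end

section
/- (Poincaré lemma.) For each N ≥ 1 let μ_N denote the uniform (normalized surface) probability measure on the sphere S^N := {x ∈ ℝ^N : ‖x‖ = √N}. Then the pushforward of μ_N under the first-coordinate map x ↦ x₁ converges weakly, as N → ∞, to the standard Gaussian measure on ℝ; that is, for every bounded continuous function f : ℝ → ℝ, ∫ f(x₁) dμ_N(x) → (2π)^{−1/2} ∫_ℝ f(u) e^{−u²/2} du. -/
open MeasureTheory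

open ProbabilityTheory Filter Complex

section RotationInvariant

variable {E : Type*} [NormedAddCommGroup E] [InnerProductSpace ℝ E] [MeasurableSpace E]
  [BorelSpace E]

/-- The characteristic function of a rotation-invariant measure is radial. -/
lemma charFun_eq_of_norm_eq {μ : Measure E} (hμ : ∀ O : E ≃ₗᵢ[ℝ] E, μ.map O = μ) {s t : E}
    (h : ‖s‖ = ‖t‖) : charFun μ s = charFun μ t := by
  set O : E ≃ₗᵢ[ℝ] E := (ℝ ∙ (s - t))ᗮ.reflection
  have hO : O s = t := Submodule.reflection_sub h
  conv_rhs => rw [← hμ O, charFun_apply, integral_map O.continuous.aemeasurable (by fun_prop)]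
  rw [charFun_apply, ← hO]
  exact integral_congr_ae (.of_forall fun x => by simp)

/-- Parseval's identity for characteristic functions. -/
lemma integral_charFun_comm [SecondCountableTopology E] (μ ν : Measure E) [IsFiniteMeasure μ]
    [IsFiniteMeasure ν] : ∫ x, charFun ν x ∂μ = ∫ y, charFun μ y ∂ν := by
  simp_rw [charFun_apply]
  rw [integral_integral_swap]
  · simp_rw [real_inner_comm]
  · refine Integrable.of_bound (C := 1) ?_ (.of_forall fun p => ?_)
    · simp only [Function.uncurry_def]
      fun_prop
    · simp [Function.uncurry_def, norm_exp_ofReal_mul_I]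

lemma norm_charFun_sub_charFun_le {μ : Measure E} [IsFiniteMeasure μ] {s t : E}
    (h : Integrable (fun x => inner ℝ x (s - t)) μ) :
    ‖charFun μ s - charFun μ t‖ ≤ ∫ x, |inner ℝ x (s - t)| ∂μ := by
  have hintegrable (u : E) : Integrable (fun x => exp (inner ℝ x u * I)) μ :=
    Integrable.of_bound (C := 1) (by fun_prop) (.of_forall fun x => by
      simp [norm_exp_ofReal_mul_I])
  rw [charFun_apply, charFun_apply, ← integral_sub (hintegrable s) (hintegrable t)]
  refine norm_integral_le_of_norm_le h.abs (.of_forall fun x => ?_)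
  have : exp (inner ℝ x s * I) - exp (inner ℝ x t * I)
      = exp (inner ℝ x t * I) * (exp (I * (inner ℝ x (s - t) : ℝ)) - 1) := by
    rw [mul_sub, ← exp_add, inner_sub_right]
    push_cast
    ring_nf
  rw [this, norm_mul, norm_exp_ofReal_mul_I, one_mul]
  exact Real.norm_exp_I_mul_ofReal_sub_one_le

end RotationInvariant

section EuclideanSpace

variable {ι : Type*} [Fintype ι]

lemma integral_sq_coord_eq_one_of_rotationInvariant [Nonempty ι]
    {μ : Measure (EuclideanSpace ℝ ι)} [IsProbabilityMeasure μ]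
    (hμ : ∀ O : EuclideanSpace ℝ ι ≃ₗᵢ[ℝ] EuclideanSpace ℝ ι, μ.map O = μ)
    (hnorm : ∀ᵐ x ∂μ, ‖x‖ = √(Fintype.card ι)) (i : ι) :
    Integrable (fun x => x i ^ 2) μ ∧ ∫ x, x i ^ 2 ∂μ = 1 := by
  classical
  have hintegrable (j : ι) : Integrable (fun x => x j ^ 2) μ := by
    refine Integrable.of_bound (C := Fintype.card ι) (by fun_prop) ?_
    filter_upwards [hnorm] with x hx
    have h := pow_le_pow_left₀ (norm_nonneg _) (PiLp.norm_apply_le x j) 2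
    rwa [hx, Real.sq_sqrt (Nat.cast_nonneg _), ← norm_pow] at h
  refine ⟨hintegrable i, ?_⟩
  have hsymm (j : ι) : ∫ x, x j ^ 2 ∂μ = ∫ x, x i ^ 2 ∂μ := by
    let O : EuclideanSpace ℝ ι ≃ₗᵢ[ℝ] EuclideanSpace ℝ ι :=
      LinearIsometryEquiv.piLpCongrLeft 2 ℝ ℝ (Equiv.swap i j)
    conv_rhs => rw [← hμ O, integral_map O.continuous.aemeasurable (by fun_prop)]
    simp [O, LinearIsometryEquiv.piLpCongrLeft_apply, Equiv.piCongrLeft'_apply]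
  have hsum : ∑ j, ∫ x, x j ^ 2 ∂μ = Fintype.card ι := by
    rw [← integral_finsetSum _ fun j _ => hintegrable j]
    have : (fun x : EuclideanSpace ℝ ι => ∑ j, x j ^ 2) =ᵐ[μ] fun _ => (Fintype.card ι : ℝ) := by
      filter_upwards [hnorm] with x hx
      rw [← EuclideanSpace.real_norm_sq_eq, hx, Real.sq_sqrt (Nat.cast_nonneg _)]
    simp [integral_congr_ae this]
  simpa [hsymm] using hsum

/-- The squared norm of a standard Gaussian vector concentrates around the dimension. -/
lemma integral_sq_norm_sub_card_stdGaussian :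
    Integrable (fun x => (‖x‖ ^ 2 - Fintype.card ι) ^ 2) (stdGaussian (EuclideanSpace ℝ ι)) ∧
    ∫ x, (‖x‖ ^ 2 - Fintype.card ι) ^ 2 ∂stdGaussian (EuclideanSpace ℝ ι)
      = Fintype.card ι * Var[fun u => u ^ 2; gaussianReal 0 1] := by
  have hL : MemLp (fun u : ℝ => u ^ 2) 2 (gaussianReal 0 1) := by
    have := (memLp_id_gaussianReal' (μ := 0) (v := 1) 4 (by simp)).norm_rpow_div 2
    convert! this using 1
    · ext u; simp
    · rw [ENNReal.eq_div_iff (by simp) (by simp)]; norm_num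
  have hmean : ∫ u, u ^ 2 ∂gaussianReal 0 1 = 1 := by
    have := variance_id_gaussianReal (μ := 0) (v := 1)
    rw [variance_eq_integral (by fun_prop)] at this
    simpa using this
  let X : (ι → ℝ) → ℝ := ∑ i, fun y => y i ^ 2
  have hX : MemLp X 2 (Measure.pi fun _ : ι => gaussianReal 0 1) :=
    memLp_finsetSum' _ fun i _ => hL.comp_measurePreserving (measurePreserving_eval _ i)
  have hXmean : ∫ y, X y ∂(Measure.pi fun _ : ι => gaussianReal 0 1) = Fintype.card ι := by
    simp only [X, Finset.sum_apply]
    have hcoord (i : ι) : Integrable (fun y : ι → ℝ => y i ^ 2)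
        (Measure.pi fun _ => gaussianReal 0 1) :=
      (hL.comp_measurePreserving (measurePreserving_eval _ i)).integrable one_le_two
    rw [integral_finsetSum _ fun i _ => hcoord i]
    have hval (i : ι) : ∫ y : ι → ℝ, y i ^ 2 ∂(Measure.pi fun _ => gaussianReal 0 1) = 1 :=
      (integral_comp_eval (μ := fun _ : ι => gaussianReal 0 1) hL.aestronglyMeasurable).trans hmean
    simp [hval]
  have hcomp (y : ι → ℝ) : (‖WithLp.toLp 2 y‖ ^ 2 - (Fintype.card ι : ℝ)) ^ 2
      = (X y - Fintype.card ι) ^ 2 := by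
    simp [EuclideanSpace.real_norm_sq_eq, X]
  have hemb : MeasurableEmbedding (WithLp.toLp 2 : (ι → ℝ) → EuclideanSpace ℝ ι) :=
    (MeasurableEquiv.toLp 2 (ι → ℝ)).measurableEmbedding
  rw [← map_pi_eq_stdGaussian, hemb.integrable_map_iff, hemb.integral_map]
  simp only [Function.comp_def, hcomp]
  refine ⟨(hX.sub (memLp_const _)).integrable_sq, ?_⟩
  have hvar := variance_sum_pi (μ := fun _ : ι => gaussianReal 0 1) fun _ => hL
  rw [variance_eq_integral hX.aestronglyMeasurable.aemeasurable, hXmean] at hvar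
  simpa using hvar

lemma integral_abs_norm_div_sqrt_card_sub_one_stdGaussian_le [Nonempty ι] :
    Integrable (fun x => |‖x‖ / √(Fintype.card ι) - 1|) (stdGaussian (EuclideanSpace ℝ ι)) ∧
    ∫ x, |‖x‖ / √(Fintype.card ι) - 1| ∂stdGaussian (EuclideanSpace ℝ ι)
      ≤ (1 + Var[fun u => u ^ 2; gaussianReal 0 1]) / √(Fintype.card ι) := by
  obtain ⟨hintegrable, hval⟩ := integral_sq_norm_sub_card_stdGaussian (ι := ι)
  have hc : (0 : ℝ) < Fintype.card ι := by exact_mod_cast Fintype.card_pos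
  set c : ℝ := (Fintype.card ι : ℝ)
  obtain ⟨s, hs, hsc⟩ : ∃ s, 0 < s ∧ c = s ^ 2 :=
    ⟨√c, Real.sqrt_pos.2 hc, (Real.sq_sqrt hc.le).symm⟩
  rw [show √c = s by rw [hsc, Real.sqrt_sq hs.le]]
  have hle (x : EuclideanSpace ℝ ι) :
      |‖x‖ / s - 1| ≤ 1 / s + (1 / s ^ 3) * (‖x‖ ^ 2 - c) ^ 2 := by
    obtain ⟨r, hr, hrx⟩ : ∃ r, 0 ≤ r ∧ ‖x‖ = r * s :=
      ⟨‖x‖ / s, by positivity, by field_simp⟩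
    have h1 : |r - 1| ≤ |r ^ 2 - 1| := by
      rw [show r ^ 2 - 1 = (r - 1) * (r + 1) by ring, abs_mul, abs_of_pos (by linarith : 0 < r + 1)]
      nlinarith [abs_nonneg (r - 1)]
    have h2 : 1 / s + (1 / s ^ 3) * (‖x‖ ^ 2 - c) ^ 2 = 1 / s + s * |r ^ 2 - 1| ^ 2 := by
      rw [hrx, hsc, sq_abs]; field_simp
    have h3 : 1 / s + s * |r ^ 2 - 1| ^ 2 - |r ^ 2 - 1|
        = ((s * |r ^ 2 - 1| - 1) ^ 2 + s * |r ^ 2 - 1|) / s := by field_simp; ring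
    have h4 : 0 ≤ ((s * |r ^ 2 - 1| - 1) ^ 2 + s * |r ^ 2 - 1|) / s := by positivity
    rw [h2, hrx, mul_div_cancel_right₀ _ hs.ne']
    linarith
  have hintegrable' : Integrable (fun x => 1 / s + (1 / s ^ 3) * (‖x‖ ^ 2 - c) ^ 2)
      (stdGaussian (EuclideanSpace ℝ ι)) := (integrable_const _).add (hintegrable.const_mul _)
  have hfin : Integrable (fun x => |‖x‖ / s - 1|) (stdGaussian (EuclideanSpace ℝ ι)) :=
    hintegrable'.mono' (by fun_prop) (.of_forall fun x => by simpa using hle x)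
  refine ⟨hfin, (integral_mono hfin hintegrable' hle).trans_eq ?_⟩
  rw [integral_add (integrable_const _) (hintegrable.const_mul _), integral_const_mul, hval, hsc]
  simp
  field_simp

/-- Quantitative Poincaré lemma at the level of characteristic functions. -/
lemma norm_charFun_coord_sub_exp_le [Nonempty ι]
    {μ : Measure (EuclideanSpace ℝ ι)} [IsProbabilityMeasure μ]
    (hμ : ∀ O : EuclideanSpace ℝ ι ≃ₗᵢ[ℝ] EuclideanSpace ℝ ι, μ.map O = μ)
    (hnorm : ∀ᵐ x ∂μ, ‖x‖ = √(Fintype.card ι)) (i : ι) (t : ℝ) :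
    ‖charFun (μ.map fun x => x i) t - exp (-(t : ℂ) ^ 2 / 2)‖
      ≤ |t| * ((1 + Var[fun u => u ^ 2; gaussianReal 0 1]) / √(Fintype.card ι)) := by
  classical
  obtain ⟨hsqint, hsq⟩ := integral_sq_coord_eq_one_of_rotationInvariant hμ hnorm i
  obtain ⟨hconcint, hconc⟩ := integral_abs_norm_div_sqrt_card_sub_one_stdGaussian_le (ι := ι)
  have hc : (0 : ℝ) < √(Fintype.card ι) := by
    rw [Real.sqrt_pos]; exact_mod_cast Fintype.card_pos
  set s : ℝ := √(Fintype.card ι)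
  set γ := stdGaussian (EuclideanSpace ℝ ι)
  have hcoord : Integrable (fun x => x i) μ := by
    refine MemLp.integrable one_le_two ((memLp_two_iff_integrable_sq ?_).2 hsqint)
    fun_prop
  have habs : ∫ x, |x i| ∂μ ≤ 1 := by
    have : ∫ x, |x i| ∂μ ≤ ∫ x, (1 / 2 + 1 / 2 * x i ^ 2) ∂μ :=
      integral_mono hcoord.abs ((integrable_const _).add (hsqint.const_mul _)) fun x => by
        nlinarith [sq_nonneg (|x i| - 1), sq_abs (x i)]
    rw [integral_add (integrable_const _) (hsqint.const_mul _), integral_const_mul, hsq] at this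
    simp at this
    linarith
  have hproj : charFun (μ.map fun x => x i) t = charFun μ (EuclideanSpace.single i t) := by
    rw [charFun_apply_real, integral_map (by fun_prop) (by fun_prop), charFun_apply]
    simp [EuclideanSpace.inner_single_right]
  have hgauss : ∫ g, charFun μ ((t / s) • g) ∂γ = exp (-(t : ℂ) ^ 2 / 2) := by
    have h1 : ∫ g, charFun μ ((t / s) • g) ∂γ = ∫ x, charFun γ ((t / s) • x) ∂μ := by
      have := integral_charFun_comm (γ.map ((t / s) • ·)) μ
      rw [integral_map (by fun_prop) (by fun_prop)] at this
      rw [this]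
      simp_rw [charFun_map_smul]
    rw [h1]
    have : (fun x => charFun γ ((t / s) • x)) =ᵐ[μ] fun _ => exp (-(t : ℂ) ^ 2 / 2) := by
      filter_upwards [hnorm] with x hx
      have : ‖(t / s) • x‖ ^ 2 = t ^ 2 := by
        rw [norm_smul, hx, mul_pow, Real.norm_eq_abs, sq_abs]; field_simp
      rw [charFun_stdGaussian, ← ofReal_pow, this]
      simp
    simp [integral_congr_ae this]
  have hpt (g : EuclideanSpace ℝ ι) :
      ‖charFun μ (EuclideanSpace.single i t) - charFun μ ((t / s) • g)‖
        ≤ |t| * |‖g‖ / s - 1| := by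
    have hrad : charFun μ ((t / s) • g) = charFun μ (EuclideanSpace.single i (t * (‖g‖ / s))) := by
      apply charFun_eq_of_norm_eq hμ
      simp [norm_smul, abs_of_pos hc]
      ring
    have hinner (x : EuclideanSpace ℝ ι) :
        inner ℝ x (EuclideanSpace.single i t - EuclideanSpace.single i (t * (‖g‖ / s)))
          = t * (1 - ‖g‖ / s) * x i := by
      simp [inner_sub_right, EuclideanSpace.inner_single_right]
      ring
    rw [hrad]
    refine (norm_charFun_sub_charFun_le ?_).trans ?_
    · simp_rw [hinner]; exact hcoord.const_mul _
    · simp_rw [hinner, abs_mul]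
      rw [integral_const_mul, abs_sub_comm]
      exact mul_le_of_le_one_right (by positivity) habs
  have hintegrable : Integrable (fun g => charFun μ ((t / s) • g)) γ :=
    Integrable.of_bound (C := 1) (by fun_prop) (.of_forall fun g => norm_charFun_le_one _)
  rw [hproj, ← hgauss]
  calc ‖charFun μ (EuclideanSpace.single i t) - ∫ g, charFun μ ((t / s) • g) ∂γ‖
      = ‖∫ g, (charFun μ (EuclideanSpace.single i t) - charFun μ ((t / s) • g)) ∂γ‖ := by
        rw [integral_sub (integrable_const _) hintegrable]; simp
    _ ≤ ∫ g, |t| * |‖g‖ / s - 1| ∂γ :=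
        norm_integral_le_of_norm_le (hconcint.const_mul _) (.of_forall hpt)
    _ ≤ _ := by rw [integral_const_mul]; gcongr

end EuclideanSpace

/-- Poincaré lemma: if `μ N` is the rotation-invariant probability measure on the sphere
of radius `√(N+1)` in `ℝ^(N+1)`, then the first coordinate converges weakly to a standard
Gaussian: for every bounded continuous `f : ℝ → ℝ`,
`∫ f(x₁) dμ_N(x) → (2π)^(-1/2) ∫ f(u) e^(-u²/2) du`. -/
theorem stmt6
    (μ : (N : ℕ) → Measure (EuclideanSpace ℝ (Fin (N + 1))))
    (hprob : ∀ N, IsProbabilityMeasure (μ N))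
    (hsupp : ∀ N, μ N (Metric.sphere (0 : EuclideanSpace ℝ (Fin (N + 1)))
      (Real.sqrt ((N : ℝ) + 1))) = 1)
    (hrot : ∀ (N : ℕ)
      (O : EuclideanSpace ℝ (Fin (N + 1)) ≃ₗᵢ[ℝ] EuclideanSpace ℝ (Fin (N + 1))),
      Measure.map O (μ N) = μ N)
    (f : ℝ → ℝ) (hf : Continuous f) (hbd : ∃ C, ∀ u, |f u| ≤ C) :
    Filter.Tendsto (fun N => ∫ x, f (x 0) ∂(μ N)) Filter.atTop
      (nhds ((Real.sqrt (2 * Real.pi))⁻¹ * ∫ u : ℝ, f u * Real.exp (-u ^ 2 / 2))) := by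
  have hnorm (N : ℕ) : ∀ᵐ x ∂μ N, ‖x‖ = √(Fintype.card (Fin (N + 1))) := by
    have h := (prob_compl_eq_zero_iff Metric.isClosed_sphere.measurableSet).2 (hsupp N)
    filter_upwards [mem_ae_iff.2 h] with x hx
    simpa using hx
  let law (N : ℕ) : ProbabilityMeasure ℝ :=
    ⟨(μ N).map fun x => x 0, Measure.isProbabilityMeasure_map (by fun_prop)⟩
  let gauss : ProbabilityMeasure ℝ := ⟨gaussianReal 0 1, inferInstance⟩
  have hlaw : Tendsto law atTop (nhds gauss) := by
    refine ProbabilityMeasure.tendsto_iff_tendsto_charFun.2 fun t => ?_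
    rw [tendsto_iff_norm_sub_tendsto_zero]
    have hlim : Tendsto (fun N : ℕ => |t| * ((1 + Var[fun u => u ^ 2; gaussianReal 0 1]) /
        √(Fintype.card (Fin (N + 1))))) atTop (nhds 0) := by
      rw [← mul_zero |t|]
      refine (Tendsto.const_div_atTop ?_ _).const_mul _
      simp only [Fintype.card_fin]
      exact Real.tendsto_sqrt_atTop.comp
        (tendsto_natCast_atTop_atTop.comp (tendsto_add_atTop_nat 1))
    refine squeeze_zero (fun _ => norm_nonneg _) (fun N => ?_) hlim
    simpa [law, gauss, charFun_gaussianReal, neg_div] using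
      norm_charFun_coord_sub_exp_le (hrot N) (hnorm N) 0 t
  obtain ⟨C, hC⟩ := hbd
  have h := ProbabilityMeasure.tendsto_iff_forall_integral_tendsto.1 hlaw
    (BoundedContinuousFunction.ofNormedAddCommGroup f hf C hC)
  convert! h using 2 with N
  · simp only [law, ProbabilityMeasure.coe_mk, BoundedContinuousFunction.coe_ofNormedAddCommGroup]
    rw [integral_map (by fun_prop) hf.aestronglyMeasurable]
  · simp only [gauss, ProbabilityMeasure.coe_mk, BoundedContinuousFunction.coe_ofNormedAddCommGroup]
    rw [integral_gaussianReal_eq_integral_smul one_ne_zero, ← integral_const_mul]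
    congr 1 with u
    simp [gaussianPDFReal]
    ring
end

section
/- (Gradient norm lower bound along gradient descent.) Let E be a finite-dimensional real inner product space, let H : E → ℝ be twice continuously differentiable, and suppose there exists Λ > 0 such that the operator norm of the Hessian satisfies ‖∇²H(x)‖_op ≤ Λ for every x ∈ E. Let Y : [0,∞) → E be continuously differentiable with Y'(t) = −∇H(Y(t)) for all t ≥ 0. Then for every t ≥ 0, ‖∇H(Y(t))‖ ≥ ‖∇H(Y(0))‖ · e^{−Λ·t}. -/
open scoped RealInnerProductSpace in
/-- If `-Λ ‖u‖²` is a lower bound for the inner product of `u` and its derivative on `[0, ∞)`,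
then `‖u‖` decays at most exponentially with rate `Λ`. -/
theorem norm_mul_exp_neg_le_norm_of_inner_deriv_ge {E : Type*} [NormedAddCommGroup E]
    [InnerProductSpace ℝ E] {u u' : ℝ → E} {Λ : ℝ}
    (hu : ∀ t ∈ Set.Ici (0 : ℝ), HasDerivWithinAt u (u' t) (Set.Ici 0) t)
    (hinner : ∀ t ∈ Set.Ici (0 : ℝ), -Λ * ‖u t‖ ^ 2 ≤ ⟪u t, u' t⟫)
    {t : ℝ} (ht : t ∈ Set.Ici (0 : ℝ)) :
    ‖u 0‖ * Real.exp (-Λ * t) ≤ ‖u t‖ := by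
  have hd : ∀ s ∈ Set.Ici (0 : ℝ), HasDerivWithinAt
      (fun s => Real.exp (2 * Λ * s) * ‖u s‖ ^ 2)
      (Real.exp (2 * Λ * s) * (2 * Λ) * ‖u s‖ ^ 2 +
        Real.exp (2 * Λ * s) * (2 * ⟪u s, u' s⟫)) (Set.Ici 0) s := by
    intro s hs
    have he : HasDerivAt (fun s => Real.exp (2 * Λ * s)) (Real.exp (2 * Λ * s) * (2 * Λ)) s :=
      (hasDerivAt_const_mul (2 * Λ)).exp
    exact he.hasDerivWithinAt.mul (hu s hs).norm_sq
  have hmono : MonotoneOn (fun s => Real.exp (2 * Λ * s) * ‖u s‖ ^ 2) (Set.Ici 0) := by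
    refine monotoneOn_of_hasDerivWithinAt_nonneg (convex_Ici 0)
      (fun s hs => (hd s hs).continuousWithinAt)
      (fun s hs => (hd s (interior_subset hs)).mono interior_subset) fun s hs => ?_
    have h := hinner s (interior_subset hs)
    calc 0 ≤ Real.exp (2 * Λ * s) * (2 * (⟪u s, u' s⟫ - -Λ * ‖u s‖ ^ 2)) :=
          mul_nonneg (Real.exp_pos _).le (by linarith)
      _ = _ := by ring
  have h := hmono Set.self_mem_Ici ht ht
  simp only [mul_zero, Real.exp_zero, one_mul] at h
  refine le_trans (le_abs_self _) (abs_le_of_sq_le_sq ?_ (norm_nonneg _))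
  calc (‖u 0‖ * Real.exp (-Λ * t)) ^ 2
      = ‖u 0‖ ^ 2 * Real.exp (-(2 * Λ * t)) := by
        rw [mul_pow, ← Real.exp_nat_mul]; congr 2; push_cast; ring
    _ ≤ Real.exp (2 * Λ * t) * ‖u t‖ ^ 2 * Real.exp (-(2 * Λ * t)) := by gcongr
    _ = ‖u t‖ ^ 2 := by
        rw [mul_right_comm, ← Real.exp_add, add_neg_cancel, Real.exp_zero, one_mul]

/-- The gradient of a `C^(n+1)` function is `C^n`. -/
theorem ContDiff.gradient {E : Type*} [NormedAddCommGroup E] [InnerProductSpace ℝ E]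
    [CompleteSpace E] {f : E → ℝ} {m n : WithTop ℕ∞} (hf : ContDiff ℝ n f) (hmn : m + 1 ≤ n) :
    ContDiff ℝ m (_root_.gradient f) :=
  (InnerProductSpace.toDual ℝ E).symm.contDiff.comp (hf.fderiv_right hmn)

/-- Gradient norm lower bound along gradient descent: if `H` is `C²` with Hessian operator
norm bounded by `Λ`, and `Y` solves `Y' = -∇H(Y)` on `[0,∞)`, then
`‖∇H(Y t)‖ ≥ ‖∇H(Y 0)‖ e^(-Λ t)` for all `t ≥ 0`. -/
theorem stmt9 {E : Type*} [NormedAddCommGroup E] [InnerProductSpace ℝ E]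
    [FiniteDimensional ℝ E]
    (H : E → ℝ) (hH : ContDiff ℝ 2 H) (Λ : ℝ) (hΛ : 0 < Λ)
    (hHess : ∀ x, ‖fderiv ℝ (gradient H) x‖ ≤ Λ)
    (Y : ℝ → E)
    (hY : ∀ t ∈ Set.Ici (0 : ℝ),
      HasDerivWithinAt Y (-(gradient H (Y t))) (Set.Ici 0) t) :
    ∀ t ∈ Set.Ici (0 : ℝ),
      ‖gradient H (Y 0)‖ * Real.exp (-Λ * t) ≤ ‖gradient H (Y t)‖ := by
  intro t ht
  have hG : ContDiff ℝ 1 (gradient H) := hH.gradient (by norm_num)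
  refine norm_mul_exp_neg_le_norm_of_inner_deriv_ge (u := fun s => gradient H (Y s))
    (u' := fun s => fderiv ℝ (gradient H) (Y s) (-(gradient H (Y s))))
    (fun s hs => ?_) (fun s _ => ?_) ht
  · exact ((hG.differentiable one_ne_zero) (Y s)).hasFDerivAt.comp_hasDerivWithinAt s (hY s hs)
  · rw [map_neg, inner_neg_right, neg_mul]
    refine neg_le_neg ((real_inner_le_norm _ _).trans ?_)
    calc _ ≤ ‖gradient H (Y s)‖ * (Λ * ‖gradient H (Y s)‖) := by
          gcongr
          exact (fderiv ℝ (gradient H) (Y s)).le_of_opNorm_le (hHess _) _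
      _ = _ := by ring
end
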